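/- Let S = {|S_j⟩ = |A_j⟩⊗|B_j⟩⊗|C_j⟩ : j = 1,2,3,4} be a three-qubit unextendible product basis. Then for every pair i ≠ j, the local states on each qubit are distinct as states: |A_i⟩ is not proportional to |A_j⟩, |B_i⟩ is not proportional to |B_j⟩, and |C_i⟩ is not proportional to |C_j⟩. -/

import Mathlib

noncomputable section

open Matrix Finset
open scoped ComplexOrder

/-- one-qubit vectors -/
abbrev V2 := Fin 2 → ℂ
/-- index set of the three-qubit space ℂ²⊗ℂ²⊗ℂ² -/
abbrev I8 := Fin 2 × Fin 2 × Fin 2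
/-- three-qubit vectors -/
abbrev V8 := I8 → ℂ
/-- one-qubit operators -/
abbrev M2 := Matrix (Fin 2) (Fin 2) ℂ
/-- three-qubit operators -/
abbrev M8 := Matrix I8 I8 ℂ

/-- inner product on ℂ², conjugate-linear in the first argument -/
def inner2 (u v : V2) : ℂ := ∑ i, star (u i) * v i

/-- inner product on ℂ²⊗ℂ²⊗ℂ², conjugate-linear in the first argument -/
def inner8 (u v : V8) : ℂ := ∑ p, star (u p) * v p

/-- tensor product |a⟩⊗|b⟩⊗|c⟩ of three one-qubit vectors -/
def tp3 (a b c : V2) : V8 := fun p => a p.1 * b p.2.1 * c p.2.2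

/-- Kronecker (tensor) product X_A⊗X_B⊗X_C of three one-qubit operators -/
def kron3 (X Y Z : M2) : M8 :=
  Matrix.of fun p q => X p.1 q.1 * Y p.2.1 q.2.1 * Z p.2.2 q.2.2

/-- a product operator on three qubits -/
def IsProductOp (X : M8) : Prop := ∃ XA XB XC : M2, X = kron3 XA XB XC

/-- the projector |v⟩⟨v| onto a vector -/
def proj8 (v : V8) : M8 := Matrix.vecMulVec v (star v)

/-- A three-qubit unextendible product basis with `n` members: mutually orthonormal
product vectors (products of unit vectors) such that the orthogonal complement of
their span contains no nonzero product vector. -/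
structure UPB (n : ℕ) where
  S : Fin n → V8
  prod : ∀ j, ∃ a b c : V2,
    inner2 a a = 1 ∧ inner2 b b = 1 ∧ inner2 c c = 1 ∧ S j = tp3 a b c
  ortho : ∀ i j, inner8 (S i) (S j) = if i = j then 1 else 0
  unext : ∀ a b c : V2, (∀ j, inner8 (S j) (tp3 a b c) = 0) → tp3 a b c = 0

/-- the bound entangled state ρ_S = (1/(8-n))(I - Σ_j |S_j⟩⟨S_j|) associated with a UPB -/
def upbState {n : ℕ} (U : UPB n) : M8 :=
  ((8 : ℂ) - (n : ℂ))⁻¹ • ((1 : M8) - ∑ j, proj8 (U.S j))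

/-- equivalence of four-member UPBs: related by local unitaries and a permutation of members -/
def UPB.Equiv (S T : UPB 4) : Prop :=
  ∃ UA UB UC : M2, UA ∈ Matrix.unitaryGroup (Fin 2) ℂ ∧
    UB ∈ Matrix.unitaryGroup (Fin 2) ℂ ∧ UC ∈ Matrix.unitaryGroup (Fin 2) ℂ ∧
    ∃ σ : Equiv.Perm (Fin 4), ∀ j, S.S j = (kron3 UA UB UC).mulVec (T.S (σ j))

/-- square root of a positive semidefinite matrix (junk value 0 otherwise) -/
def msqrt {m : Type*} [Fintype m] [DecidableEq m] (A : Matrix m m ℂ) : Matrix m m ℂ :=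
  open scoped Classical in if h : A.PosSemidef then
    (h.1.eigenvectorUnitary : Matrix m m ℂ) *
      Matrix.diagonal (fun i => ((Real.sqrt (h.1.eigenvalues i) : ℝ) : ℂ)) *
      (star h.1.eigenvectorUnitary : Matrix m m ℂ) else 0

/-- fidelity F(ρ,σ) = tr √(√ρ σ √ρ) of positive semidefinite matrices -/
def fidelity {m : Type*} [Fintype m] [DecidableEq m] (ρ σ : Matrix m m ℂ) : ℝ :=
  ((msqrt (msqrt ρ * σ * msqrt ρ)).trace).re

/-- a vector orthogonal to `u`, obtained by conjugating and rotating its coordinates -/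
def perp2 (u : V2) : V2 := ![-star (u 1), star (u 0)]

lemma inner2_perp2 (u : V2) : inner2 u (perp2 u) = 0 := by
  simp [inner2, perp2, Fin.sum_univ_two]
  ring

lemma perp2_ne_zero {u : V2} (hu : inner2 u u = 1) : perp2 u ≠ 0 := by
  intro h
  have h0 : u 1 = 0 := by simpa [perp2] using congrFun h 0
  have h1 : u 0 = 0 := by simpa [perp2] using congrFun h 1
  simp [inner2, Fin.sum_univ_two, h0, h1] at hu

lemma inner2_smul_left (z : ℂ) (u v : V2) : inner2 (z • u) v = star z * inner2 u v := by
  simp [inner2, mul_assoc, mul_add]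

lemma inner8_tp3 (a b c a' b' c' : V2) :
    inner8 (tp3 a b c) (tp3 a' b' c') = inner2 a a' * inner2 b b' * inner2 c c' := by
  simp [inner8, inner2, tp3, Fintype.sum_prod_type, Fin.sum_univ_two]
  ring

lemma tp3_ne_zero {a b c : V2} (ha : a ≠ 0) (hb : b ≠ 0) (hc : c ≠ 0) : tp3 a b c ≠ 0 := by
  obtain ⟨i, hi⟩ := Function.ne_iff.mp ha
  obtain ⟨j, hj⟩ := Function.ne_iff.mp hb
  obtain ⟨k, hk⟩ := Function.ne_iff.mp hc
  exact Function.ne_iff.mpr ⟨(i, j, k), mul_ne_zero (mul_ne_zero hi hj) hk⟩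

/-- No nonzero product vector has, for every member of a UPB, an orthogonal local factor. -/
lemma UPB.exists_inner2_ne_zero {n : ℕ} (S : UPB n) {A B C : Fin n → V2}
    (hS : ∀ j, S.S j = tp3 (A j) (B j) (C j)) {a b c : V2}
    (ha : a ≠ 0) (hb : b ≠ 0) (hc : c ≠ 0) :
    ∃ j, inner2 (A j) a ≠ 0 ∧ inner2 (B j) b ≠ 0 ∧ inner2 (C j) c ≠ 0 := by
  by_contra! h
  refine tp3_ne_zero ha hb hc (S.unext a b c fun j => ?_)
  rw [hS, inner8_tp3, mul_assoc, mul_eq_zero, mul_eq_zero]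
  by_cases h1 : inner2 (A j) a = 0
  · exact Or.inl h1
  · by_cases h2 : inner2 (B j) b = 0
    · exact Or.inr (Or.inl h2)
    · exact Or.inr (Or.inr (h j h1 h2))

lemma Fin.exists_cover_four_of_ne :
    ∀ i j : Fin 4, i ≠ j → ∃ k l, ∀ m, m = i ∨ m = j ∨ m = k ∨ m = l := by
  decide

lemma inner2_perp2_of_eq_smul {u v : V2} {z : ℂ} (h : u = z • v) : inner2 u (perp2 v) = 0 := by
  rw [h, inner2_smul_left, inner2_perp2, mul_zero]

/-- in a three-qubit UPB with members |S_j⟩ = |A_j⟩⊗|B_j⟩⊗|C_j⟩,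
the local states on each qubit are pairwise non-proportional. -/
theorem stmt17 (S : UPB 4) (A B C : Fin 4 → V2)
    (hunit : ∀ j, inner2 (A j) (A j) = 1 ∧ inner2 (B j) (B j) = 1 ∧
      inner2 (C j) (C j) = 1)
    (hS : ∀ j, S.S j = tp3 (A j) (B j) (C j)) :
    ∀ i j, i ≠ j →
      (∀ z : ℂ, A i ≠ z • A j) ∧ (∀ z : ℂ, B i ≠ z • B j) ∧
      (∀ z : ℂ, C i ≠ z • C j) := by
  intro i j hij
  obtain ⟨k, l, hkl⟩ := Fin.exists_cover_four_of_ne i j hij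
  refine ⟨fun z hz => ?_, fun z hz => ?_, fun z hz => ?_⟩
  · obtain ⟨m, hA, hB, hC⟩ := S.exists_inner2_ne_zero hS (perp2_ne_zero (hunit j).1)
      (perp2_ne_zero (hunit k).2.1) (perp2_ne_zero (hunit l).2.2)
    rcases hkl m with rfl | rfl | rfl | rfl
    exacts [hA (inner2_perp2_of_eq_smul hz), hA (inner2_perp2 _), hB (inner2_perp2 _),
      hC (inner2_perp2 _)]
  · obtain ⟨m, hA, hB, hC⟩ := S.exists_inner2_ne_zero hS (perp2_ne_zero (hunit k).1)
      (perp2_ne_zero (hunit j).2.1) (perp2_ne_zero (hunit l).2.2)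
    rcases hkl m with rfl | rfl | rfl | rfl
    exacts [hB (inner2_perp2_of_eq_smul hz), hB (inner2_perp2 _), hA (inner2_perp2 _),
      hC (inner2_perp2 _)]
  · obtain ⟨m, hA, hB, hC⟩ := S.exists_inner2_ne_zero hS (perp2_ne_zero (hunit k).1)
      (perp2_ne_zero (hunit l).2.1) (perp2_ne_zero (hunit j).2.2)
    rcases hkl m with rfl | rfl | rfl | rfl
    exacts [hC (inner2_perp2_of_eq_smul hz), hC (inner2_perp2 _), hA (inner2_perp2 _),
      hB (inner2_perp2 _)]
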